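/- In Cl(3), the images ι(r₁), ι(r₂), ι(r₃) of the H₃ simple roots r₁ = (0,1,0), r₂ = −½(τ−1, 1, τ), r₃ = (0,0,1) each square to 1 (hence are self-inverse units), and the subgroup of the unit group Cl(3)ˣ that they generate has exactly 240 elements (the pinor double cover of the full icosahedral group H₃ of order 120). -/

import Mathlib

noncomputable section

/-- The positive definite quadratic form `Q(v) = v₁² + v₂² + v₃²` on `ℝ³`. -/
def Q3 : QuadraticForm ℝ (Fin 3 → ℝ) :=
  QuadraticMap.weightedSumSquares ℝ (fun _ : Fin 3 => (1 : ℝ))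

/-- The golden ratio `τ = (1+√5)/2`. -/
def τ : ℝ := (1 + Real.sqrt 5) / 2

/-- The simple root `r₁ = (0,1,0)` of `H₃`. -/
def r₁ : Fin 3 → ℝ := ![0, 1, 0]

/-- The simple root `r₂ = −½(τ−1, 1, τ)` of `H₃`. -/
def r₂ : Fin 3 → ℝ := ![-((τ - 1) / 2), -(1 / 2), -(τ / 2)]

/-- The simple root `r₃ = (0,0,1)` of `H₃`. -/
def r₃ : Fin 3 → ℝ := ![0, 0, 1]

/-- The pinor group: the subgroup of `Cl(3)ˣ` generated by `ι r₁`, `ι r₂`, `ι r₃`. -/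
def PinH3 : Subgroup (CliffordAlgebra Q3)ˣ :=
  Subgroup.closure {u : (CliffordAlgebra Q3)ˣ |
    (u : CliffordAlgebra Q3) = CliffordAlgebra.ι Q3 r₁ ∨
    (u : CliffordAlgebra Q3) = CliffordAlgebra.ι Q3 r₂ ∨
    (u : CliffordAlgebra Q3) = CliffordAlgebra.ι Q3 r₃}

/-- Integer model: `(a + b τ)/2` in each of the eight Clifford coordinates. -/
structure MV where
  a0 : Int
  a1 : Int
  a2 : Int
  a3 : Int
  a4 : Int
  a5 : Int
  a6 : Int
  a7 : Int
  b0 : Int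
  b1 : Int
  b2 : Int
  b3 : Int
  b4 : Int
  b5 : Int
  b6 : Int
  b7 : Int
  deriving DecidableEq

namespace MV

/-- left multiplication by `e₁` -/
def E1 (x : MV) : MV :=
  ⟨x.a1, x.a0, x.a4, x.a5, x.a2, x.a3, x.a7, x.a6,
   x.b1, x.b0, x.b4, x.b5, x.b2, x.b3, x.b7, x.b6⟩

/-- left multiplication by `e₂` -/
def E2 (x : MV) : MV :=
  ⟨x.a2, -x.a4, x.a0, x.a6, -x.a1, -x.a7, x.a3, -x.a5,
   x.b2, -x.b4, x.b0, x.b6, -x.b1, -x.b7, x.b3, -x.b5⟩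

/-- left multiplication by `e₃` -/
def E3 (x : MV) : MV :=
  ⟨x.a3, -x.a5, -x.a6, x.a0, x.a7, -x.a1, -x.a2, x.a4,
   x.b3, -x.b5, -x.b6, x.b0, x.b7, -x.b1, -x.b2, x.b4⟩

/-- twice left multiplication by `r₂`, from the products with `e₁`, `e₂`, `e₃`. -/
def comb (x y z : MV) : MV :=
  ⟨-((x.b0 - x.a0) + y.a0 + z.b0), -((x.b1 - x.a1) + y.a1 + z.b1),
   -((x.b2 - x.a2) + y.a2 + z.b2), -((x.b3 - x.a3) + y.a3 + z.b3),
   -((x.b4 - x.a4) + y.a4 + z.b4), -((x.b5 - x.a5) + y.a5 + z.b5),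
   -((x.b6 - x.a6) + y.a6 + z.b6), -((x.b7 - x.a7) + y.a7 + z.b7),
   -(x.a0 + y.b0 + (z.a0 + z.b0)), -(x.a1 + y.b1 + (z.a1 + z.b1)),
   -(x.a2 + y.b2 + (z.a2 + z.b2)), -(x.a3 + y.b3 + (z.a3 + z.b3)),
   -(x.a4 + y.b4 + (z.a4 + z.b4)), -(x.a5 + y.b5 + (z.a5 + z.b5)),
   -(x.a6 + y.b6 + (z.a6 + z.b6)), -(x.a7 + y.b7 + (z.a7 + z.b7))⟩

/-- twice left multiplication by `r₂` -/
def N (x : MV) : MV := comb (E1 x) (E2 x) (E3 x)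

/-- halving -/
def half (x : MV) : MV :=
  ⟨x.a0 / 2, x.a1 / 2, x.a2 / 2, x.a3 / 2, x.a4 / 2, x.a5 / 2, x.a6 / 2, x.a7 / 2,
   x.b0 / 2, x.b1 / 2, x.b2 / 2, x.b3 / 2, x.b4 / 2, x.b5 / 2, x.b6 / 2, x.b7 / 2⟩

/-- doubling -/
def dbl (x : MV) : MV :=
  ⟨2 * x.a0, 2 * x.a1, 2 * x.a2, 2 * x.a3, 2 * x.a4, 2 * x.a5, 2 * x.a6, 2 * x.a7,
   2 * x.b0, 2 * x.b1, 2 * x.b2, 2 * x.b3, 2 * x.b4, 2 * x.b5, 2 * x.b6, 2 * x.b7⟩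

/-- left multiplication by `r₂` -/
def G2 (x : MV) : MV := half (N x)

/-- the unit -/
def one : MV := ⟨2, 0, 0, 0, 0, 0, 0, 0, 0, 0, 0, 0, 0, 0, 0, 0⟩

/-- A hash code -/
def code (x : MV) : Nat :=
  [x.a0, x.a1, x.a2, x.a3, x.a4, x.a5, x.a6, x.a7,
   x.b0, x.b1, x.b2, x.b3, x.b4, x.b5, x.b6, x.b7].foldr
    (fun a n => Nat.add (Int.toNat (a + 8)) (Nat.mul 16 n)) 0

/-- Membership test that compares hash codes first -/
def memb (m : MV) : List MV → Bool
  | [] => false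
  | s :: t =>
    match Nat.beq (code m) (code s) with
    | true => decide (m = s) || memb m t
    | false => memb m t

theorem memb_iff (m : MV) (l : List MV) : memb m l = true ↔ m ∈ l := by
  induction l with
  | nil => simp [memb]
  | cons s t ih =>
    rw [memb, List.mem_cons]
    split
    · simp [ih]
    · rename_i h
      have hne : m ≠ s := by
        rintro rfl
        simp at h
      simp [ih, hne]

/-- depth first search through the orbit of the generators -/
def search : Nat → List MV → List MV → Option (List MV)
  | 0, _, _ => none
  | _ + 1, [], seen => some seen
  | n + 1, m :: q, seen =>
    if memb m seen then search n q seen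
    else if dbl (G2 m) = N m then search n (E2 m :: G2 m :: E3 m :: q) (m :: seen)
    else none

theorem search_length : (search 1000 [one] []).map List.length = some 240 := by decide +kernel

theorem search_spec (P : MV → Prop)
    (hP : ∀ m, P m → dbl (G2 m) = N m → P (E2 m) ∧ P (G2 m) ∧ P (E3 m)) (L : List MV) :
    ∀ (n : Nat) (q seen : List MV), search n q seen = some L → seen.Nodup →
      (∀ m ∈ seen, dbl (G2 m) = N m ∧ (E2 m ∈ seen ∨ E2 m ∈ q) ∧ (G2 m ∈ seen ∨ G2 m ∈ q) ∧
        (E3 m ∈ seen ∨ E3 m ∈ q)) →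
      (∀ m ∈ seen, P m) → (∀ m ∈ q, P m) →
      L.Nodup ∧ (∀ m ∈ L, dbl (G2 m) = N m ∧ E2 m ∈ L ∧ G2 m ∈ L ∧ E3 m ∈ L) ∧
        (∀ m ∈ L, P m) ∧ (∀ m ∈ seen, m ∈ L) ∧ (∀ m ∈ q, m ∈ L) := by
  intro n
  induction n with
  | zero => intro q seen h; simp [search] at h
  | succ n ih =>
    intro q seen h hn hc hs hq
    cases q with
    | nil =>
      simp only [search, Option.some.injEq] at h
      subst h
      simp only [List.not_mem_nil, or_false] at hc
      exact ⟨hn, hc, hs, fun _ h => h, by simp⟩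
    | cons m q =>
      simp only [search, memb_iff] at h
      split_ifs at h with h1 h2
      · obtain ⟨i1, i2, i3, i4, i5⟩ := ih q seen h hn (by
          intro x hx
          obtain ⟨c0, c1, c2, c3⟩ := hc x hx
          simp only [List.mem_cons] at c1 c2 c3
          refine ⟨c0, ?_, ?_, ?_⟩
          · rcases c1 with c | c | c
            · exact Or.inl c
            · rw [c]; exact Or.inl h1
            · exact Or.inr c
          · rcases c2 with c | c | c
            · exact Or.inl c
            · rw [c]; exact Or.inl h1
            · exact Or.inr c
          · rcases c3 with c | c | c
            · exact Or.inl c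
            · rw [c]; exact Or.inl h1
            · exact Or.inr c) hs (fun x hx => hq x (List.mem_cons_of_mem _ hx))
        refine ⟨i1, i2, i3, i4, ?_⟩
        intro x hx
        rcases List.mem_cons.1 hx with rfl | hx
        · exact i4 _ h1
        · exact i5 _ hx
      · have hm := hq m (by simp)
        obtain ⟨p1, p2, p3⟩ := hP m hm h2
        obtain ⟨i1, i2, i3, i4, i5⟩ := ih _ _ h (List.nodup_cons.2 ⟨h1, hn⟩) (by
          intro x hx
          simp only [List.mem_cons] at hx hc ⊢
          rcases hx with rfl | hx
          · simp [h2]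
          · obtain ⟨c0, c1, c2, c3⟩ := hc x hx
            refine ⟨c0, ?_, ?_, ?_⟩ <;> tauto)
          (by
            intro x hx
            rcases List.mem_cons.1 hx with rfl | hx
            · exact hm
            · exact hs x hx)
          (by
            intro x hx
            simp only [List.mem_cons] at hx
            rcases hx with rfl | rfl | rfl | hx
            · exact p1
            · exact p2
            · exact p3
            · exact hq x (List.mem_cons_of_mem _ hx))
        refine ⟨i1, i2, i3, fun x hx => i4 x (List.mem_cons_of_mem _ hx), ?_⟩
        intro x hx
        rcases List.mem_cons.1 hx with rfl | hx
        · exact i4 _ (by simp)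
        · exact i5 _ (by simp [hx])

end MV

/-- basis vectors of the Clifford algebra -/
def ee (i : Fin 3) : CliffordAlgebra Q3 := CliffordAlgebra.ι Q3 (Pi.single i 1)

theorem Q3_apply (v : Fin 3 → ℝ) : Q3 v = v 0 * v 0 + v 1 * v 1 + v 2 * v 2 := by
  simp [Q3, QuadraticMap.weightedSumSquares_apply, Fin.sum_univ_three]

theorem ee_sq (i : Fin 3) : ee i * ee i = 1 := by
  rw [ee, CliffordAlgebra.ι_sq_scalar, Q3_apply]
  fin_cases i <;> simp

theorem ee_anti (i j : Fin 3) (h : i ≠ j) : ee i * ee j = - (ee j * ee i) := by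
  rw [eq_neg_iff_add_eq_zero, ee, ee, CliffordAlgebra.ι_mul_ι_add_swap, QuadraticMap.polar,
    Q3_apply, Q3_apply, Q3_apply]
  fin_cases i <;> fin_cases j <;> simp at h ⊢

theorem ι_eq (v : Fin 3 → ℝ) :
    CliffordAlgebra.ι Q3 v = v 0 • ee 0 + v 1 • ee 1 + v 2 • ee 2 := by
  simp only [ee, ← map_smul, ← map_add]
  congr 1
  ext i
  fin_cases i <;> simp

theorem τ_sq : τ * τ = τ + 1 := by
  have h : Real.sqrt 5 * Real.sqrt 5 = 5 := Real.mul_self_sqrt (by norm_num)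
  unfold τ
  linear_combination h / 4

theorem ι_sq_one (v : Fin 3 → ℝ) (h : v 0 * v 0 + v 1 * v 1 + v 2 * v 2 = 1) :
    CliffordAlgebra.ι Q3 v * CliffordAlgebra.ι Q3 v = 1 := by
  rw [CliffordAlgebra.ι_sq_scalar, Q3_apply, h, map_one]

theorem r₁_sq : CliffordAlgebra.ι Q3 r₁ * CliffordAlgebra.ι Q3 r₁ = 1 :=
  ι_sq_one _ (by simp [r₁])

theorem r₂_sq : CliffordAlgebra.ι Q3 r₂ * CliffordAlgebra.ι Q3 r₂ = 1 :=
  ι_sq_one _ (by simp [r₂]; linear_combination τ_sq / 2)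

theorem r₃_sq : CliffordAlgebra.ι Q3 r₃ * CliffordAlgebra.ι Q3 r₃ = 1 :=
  ι_sq_one _ (by simp [r₃])

/-- The element with given coordinates -/
def F8 (x : Fin 8 → ℝ) : CliffordAlgebra Q3 :=
  x 0 • 1 + x 1 • ee 0 + x 2 • ee 1 + x 3 • ee 2 + x 4 • (ee 0 * ee 1) + x 5 • (ee 0 * ee 2) +
    x 6 • (ee 1 * ee 2) + x 7 • (ee 0 * (ee 1 * ee 2))

theorem ee0_F8 (x : Fin 8 → ℝ) :
    ee 0 * F8 x = F8 ![x 1, x 0, x 4, x 5, x 2, x 3, x 7, x 6] := by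
  have h (y : CliffordAlgebra Q3) : ee 0 * (ee 0 * y) = y := by rw [← mul_assoc, ee_sq, one_mul]
  simp [F8, mul_add, h, ee_sq]
  abel

theorem ee1_F8 (x : Fin 8 → ℝ) :
    ee 1 * F8 x = F8 ![x 2, -x 4, x 0, x 6, -x 1, -x 7, x 3, -x 5] := by
  have h (y : CliffordAlgebra Q3) : ee 1 * (ee 1 * y) = y := by rw [← mul_assoc, ee_sq, one_mul]
  have h0 : ee 1 * ee 0 = - (ee 0 * ee 1) := ee_anti _ _ (by decide)
  have h0' (y : CliffordAlgebra Q3) : ee 1 * (ee 0 * y) = - (ee 0 * (ee 1 * y)) := by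
    rw [← mul_assoc, h0, neg_mul, mul_assoc]
  simp [F8, mul_add, h, h0, h0', ee_sq]
  abel

theorem ee2_F8 (x : Fin 8 → ℝ) :
    ee 2 * F8 x = F8 ![x 3, -x 5, -x 6, x 0, x 7, -x 1, -x 2, x 4] := by
  have h (y : CliffordAlgebra Q3) : ee 2 * (ee 2 * y) = y := by rw [← mul_assoc, ee_sq, one_mul]
  have h0 : ee 2 * ee 0 = - (ee 0 * ee 2) := ee_anti _ _ (by decide)
  have h1 : ee 2 * ee 1 = - (ee 1 * ee 2) := ee_anti _ _ (by decide)
  have h0' (y : CliffordAlgebra Q3) : ee 2 * (ee 0 * y) = - (ee 0 * (ee 2 * y)) := by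
    rw [← mul_assoc, h0, neg_mul, mul_assoc]
  have h1' (y : CliffordAlgebra Q3) : ee 2 * (ee 1 * y) = - (ee 1 * (ee 2 * y)) := by
    rw [← mul_assoc, h1, neg_mul, mul_assoc]
  simp [F8, mul_add, h, h0, h0', h1, h1', ee_sq]
  abel

/-- Pauli matrices -/
def pauli : (Fin 3 → ℝ) →ₗ[ℝ] Matrix (Fin 2) (Fin 2) ℂ where
  toFun v := !![(v 2 : ℂ), v 0 - Complex.I * v 1; v 0 + Complex.I * v 1, -v 2]
  map_add' v w := by
    ext i j
    fin_cases i <;> fin_cases j <;> simp <;> ring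
  map_smul' c v := by
    ext i j
    fin_cases i <;> fin_cases j <;> simp <;> ring

/-- The spin representation -/
def spinRep : CliffordAlgebra Q3 →ₐ[ℝ] Matrix (Fin 2) (Fin 2) ℂ :=
  CliffordAlgebra.lift Q3 ⟨pauli, fun v => by
    have hI := Complex.I_mul_I
    rw [Q3_apply]
    ext i j
    fin_cases i <;> fin_cases j <;>
      simp [pauli, Matrix.mul_apply, Matrix.algebraMap_matrix_apply] <;> 
      first
      | ring1
      | linear_combination (-(v 1 : ℂ) * v 1) * hI⟩

theorem spinRep_ee (i : Fin 3) : spinRep (ee i) = pauli (Pi.single i 1) := by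
  simp [spinRep, ee]

theorem F8_inj (x y : Fin 8 → ℝ) (h : F8 x = F8 y) : x = y := by
  have h' := congrArg spinRep h
  simp only [F8, map_add, map_smul, map_mul, map_one, spinRep_ee] at h'
  have h00 := congrFun (congrFun h' 0) 0
  have h01 := congrFun (congrFun h' 0) 1
  have h10 := congrFun (congrFun h' 1) 0
  have h11 := congrFun (congrFun h' 1) 1
  simp [pauli, Matrix.mul_apply, Complex.ext_iff] at h00 h01 h10 h11
  ext i
  fin_cases i <;> simp <;> linarith

/-- Real coordinates of an element of the integer model -/
def MV.coord (m : MV) : Fin 8 → ℝ :=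
  ![(m.a0 + m.b0 * τ) / 2, (m.a1 + m.b1 * τ) / 2, (m.a2 + m.b2 * τ) / 2, (m.a3 + m.b3 * τ) / 2,
    (m.a4 + m.b4 * τ) / 2, (m.a5 + m.b5 * τ) / 2, (m.a6 + m.b6 * τ) / 2, (m.a7 + m.b7 * τ) / 2]

theorem τ_indep (a b c d : ℤ) (h : ((a : ℝ) + b * τ) / 2 = (c + d * τ) / 2) : a = c ∧ b = d := by
  have hirr : Irrational (Real.sqrt 5) := Nat.Prime.irrational_sqrt (p := 5) (by norm_num)
  have hbd : b = d := by
    by_contra hne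
    have hne' : ((b : ℝ) - d) ≠ 0 := by
      rw [sub_ne_zero]; exact_mod_cast hne
    apply hirr
    refine ⟨(2 * (c - a) / (b - d) - 1 : ℚ), ?_⟩
    push_cast
    unfold τ at h
    field_simp
    linear_combination (-4) * h
  subst hbd
  refine ⟨?_, rfl⟩
  have : (a : ℝ) = c := by linarith
  exact_mod_cast this

theorem MV.coord_inj (m n : MV) (h : m.coord = n.coord) : m = n := by
  have h0 := τ_indep _ _ _ _ (congrFun h 0)
  have h1 := τ_indep _ _ _ _ (congrFun h 1)
  have h2 := τ_indep _ _ _ _ (congrFun h 2)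
  have h3 := τ_indep _ _ _ _ (congrFun h 3)
  have h4 := τ_indep _ _ _ _ (congrFun h 4)
  have h5 := τ_indep _ _ _ _ (congrFun h 5)
  have h6 := τ_indep _ _ _ _ (congrFun h 6)
  have h7 := τ_indep _ _ _ _ (congrFun h 7)
  cases m
  cases n
  simp_all

/-- The Clifford element of a model element -/
def MV.toCl (m : MV) : CliffordAlgebra Q3 := F8 m.coord

theorem MV.toCl_inj : Function.Injective MV.toCl := fun _ _ h => MV.coord_inj _ _ (F8_inj _ _ h)

theorem MV.toCl_one : MV.one.toCl = 1 := by
  simp [MV.toCl, MV.coord, MV.one, F8]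

theorem MV.toCl_E1 (m : MV) : (MV.E1 m).toCl = ee 0 * m.toCl := by
  rw [MV.toCl, MV.toCl, ee0_F8]
  congr 1

theorem MV.toCl_E2 (m : MV) : (MV.E2 m).toCl = ee 1 * m.toCl := by
  rw [MV.toCl, MV.toCl, ee1_F8]
  congr 1
  ext i
  fin_cases i <;> simp [MV.coord, MV.E2] <;> ring

theorem MV.toCl_E3 (m : MV) : (MV.E3 m).toCl = ee 2 * m.toCl := by
  rw [MV.toCl, MV.toCl, ee2_F8]
  congr 1
  ext i
  fin_cases i <;> simp [MV.coord, MV.E3] <;> ring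

theorem F8_comb (p q r : ℝ) (x y z : Fin 8 → ℝ) :
    p • F8 x + q • F8 y + r • F8 z = F8 (p • x + q • y + r • z) := by
  simp only [F8, Pi.add_apply, Pi.smul_apply, smul_eq_mul]
  module

theorem MV.toCl_comb (x y z : MV) :
    (-(τ - 1)) • x.toCl + (-1 : ℝ) • y.toCl + (-τ) • z.toCl = (MV.comb x y z).toCl := by
  simp only [MV.toCl]
  rw [F8_comb]
  have h := τ_sq
  congr 1
  ext i
  fin_cases i <;> simp [MV.coord, MV.comb]
  · linear_combination (-(x.b0 + z.b0 : ℝ) / 2) * h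
  · linear_combination (-(x.b1 + z.b1 : ℝ) / 2) * h
  · linear_combination (-(x.b2 + z.b2 : ℝ) / 2) * h
  · linear_combination (-(x.b3 + z.b3 : ℝ) / 2) * h
  · linear_combination (-(x.b4 + z.b4 : ℝ) / 2) * h
  · linear_combination (-(x.b5 + z.b5 : ℝ) / 2) * h
  · linear_combination (-(x.b6 + z.b6 : ℝ) / 2) * h
  · linear_combination (-(x.b7 + z.b7 : ℝ) / 2) * h

theorem MV.toCl_dbl (m : MV) : (MV.dbl m).toCl = (2 : ℝ) • m.toCl := by
  have h := F8_comb 2 0 0 m.coord 0 0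
  simp only [zero_smul, add_zero] at h
  rw [MV.toCl, MV.toCl, h]
  congr 1
  ext i
  fin_cases i <;> simp [MV.coord, MV.dbl] <;> ring

theorem toCl_r₁ (m : MV) : CliffordAlgebra.ι Q3 r₁ * m.toCl = (MV.E2 m).toCl := by
  rw [MV.toCl_E2, ι_eq]
  simp [r₁]

theorem toCl_r₃ (m : MV) : CliffordAlgebra.ι Q3 r₃ * m.toCl = (MV.E3 m).toCl := by
  rw [MV.toCl_E3, ι_eq]
  simp [r₃]

theorem toCl_r₂ (m : MV) (hm : MV.dbl (MV.G2 m) = MV.N m) :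
    CliffordAlgebra.ι Q3 r₂ * m.toCl = (MV.G2 m).toCl := by
  have h1 : (2 : ℝ) • (MV.G2 m).toCl = (2 : ℝ) • (CliffordAlgebra.ι Q3 r₂ * m.toCl) := by
    rw [← MV.toCl_dbl, hm, MV.N, ← MV.toCl_comb, MV.toCl_E1, MV.toCl_E2, MV.toCl_E3, ι_eq]
    simp only [r₂, Matrix.cons_val_zero, Matrix.cons_val_one, Matrix.cons_val, add_mul,
      smul_mul_assoc]
    module
  exact (smul_right_injective _ (two_ne_zero (α := ℝ)) h1).symm

/-- A square root of one, as a unit -/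
def sqUnit (x : CliffordAlgebra Q3) (h : x * x = 1) : (CliffordAlgebra Q3)ˣ := ⟨x, x, h, h⟩

theorem card_PinH3 : Nat.card PinH3 = 240 := by
  have hlen := MV.search_length
  obtain ⟨L, hL, hL240⟩ := Option.map_eq_some_iff.1 hlen
  have hg1 : sqUnit _ r₁_sq ∈ PinH3 := Subgroup.subset_closure (Or.inl rfl)
  have hg2 : sqUnit _ r₂_sq ∈ PinH3 := Subgroup.subset_closure (Or.inr (Or.inl rfl))
  have hg3 : sqUnit _ r₃_sq ∈ PinH3 := Subgroup.subset_closure (Or.inr (Or.inr rfl))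
  obtain ⟨hnd, hcl, hmem, -, hone⟩ := MV.search_spec
    (fun m => ∃ u ∈ PinH3, (u : CliffordAlgebra Q3) = m.toCl) (by
      rintro m ⟨u, hu, hum⟩ hm
      refine ⟨⟨_, PinH3.mul_mem hg1 hu, ?_⟩, ⟨_, PinH3.mul_mem hg2 hu, ?_⟩,
        ⟨_, PinH3.mul_mem hg3 hu, ?_⟩⟩
      · rw [← toCl_r₁, ← hum]; rfl
      · rw [← toCl_r₂ m hm, ← hum]; rfl
      · rw [← toCl_r₃, ← hum]; rfl) L _ _ _ hL (by simp) (by simp) (by simp) (by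
      intro m hm
      rw [List.mem_singleton.1 hm]
      exact ⟨1, PinH3.one_mem, by rw [MV.toCl_one]; rfl⟩)
  have hone' : MV.one ∈ L := hone _ (by simp)
  have hself (x : CliffordAlgebra Q3) (h : x * x = 1) (u : (CliffordAlgebra Q3)ˣ)
      (hu : (u : CliffordAlgebra Q3) = x) : ((u⁻¹ : (CliffordAlgebra Q3)ˣ) : CliffordAlgebra Q3) = x := by
    have : u = sqUnit x h := Units.ext hu
    rw [this]; rfl
  have hsub : ∀ u ∈ PinH3, ∃ m ∈ L, (u : CliffordAlgebra Q3) = m.toCl := by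
    have step (x : CliffordAlgebra Q3) (hx : x = CliffordAlgebra.ι Q3 r₁ ∨
        x = CliffordAlgebra.ι Q3 r₂ ∨ x = CliffordAlgebra.ι Q3 r₃) (m : MV) (hm : m ∈ L) :
        ∃ n ∈ L, x * m.toCl = n.toCl := by
      obtain ⟨c0, c1, c2, c3⟩ := hcl m hm
      rcases hx with rfl | rfl | rfl
      · exact ⟨_, c1, toCl_r₁ m⟩
      · exact ⟨_, c2, toCl_r₂ m c0⟩
      · exact ⟨_, c3, toCl_r₃ m⟩
    intro u hu
    induction hu using Subgroup.closure_induction_left with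
    | one => exact ⟨_, hone', by rw [MV.toCl_one]; rfl⟩
    | mul_left x hx y hy ih =>
      obtain ⟨m, hm, e⟩ := ih
      rw [Units.val_mul, e]
      exact step x hx m hm
    | inv_mul_cancel x hx y hy ih =>
      obtain ⟨m, hm, e⟩ := ih
      rw [Units.val_mul, e]
      refine step _ ?_ m hm
      rcases hx with h | h | h
      · exact Or.inl (hself _ r₁_sq _ h)
      · exact Or.inr (Or.inl (hself _ r₂_sq _ h))
      · exact Or.inr (Or.inr (hself _ r₃_sq _ h))
  have himg : ((fun u : (CliffordAlgebra Q3)ˣ => (u : CliffordAlgebra Q3)) ''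
      (PinH3 : Set (CliffordAlgebra Q3)ˣ)) = MV.toCl '' (L.toFinset : Set MV) := by
    ext x
    constructor
    · rintro ⟨u, hu, rfl⟩
      obtain ⟨m, hm, e⟩ := hsub u hu
      exact ⟨m, by simpa using hm, e.symm⟩
    · rintro ⟨m, hm, rfl⟩
      obtain ⟨u, hu, e⟩ := hmem m (by simpa using hm)
      exact ⟨u, hu, e⟩
  have hcard := congrArg Set.ncard himg
  rw [Set.ncard_image_of_injective _ Units.val_injective,
    Set.ncard_image_of_injective _ MV.toCl_inj, Set.ncard_coe_finset,
    List.toFinset_card_of_nodup hnd, hL240] at hcard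
  rw [← hcard]
  exact Nat.card_coe_set_eq _

/-- In `Cl(3)`, the images of the `H₃` simple roots square to `1` (hence are self-inverse
units), and the subgroup of `Cl(3)ˣ` they generate has exactly 240 elements
(the pinor double cover of the full icosahedral group `H₃` of order 120). -/
theorem pinor_group_of_H3 :
    (CliffordAlgebra.ι Q3 r₁) ^ 2 = 1 ∧
    (CliffordAlgebra.ι Q3 r₂) ^ 2 = 1 ∧
    (CliffordAlgebra.ι Q3 r₃) ^ 2 = 1 ∧
    Nat.card PinH3 = 240 := by
  rw [pow_two, pow_two, pow_two]
  exact ⟨r₁_sq, r₂_sq, r₃_sq, card_PinH3⟩
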